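/- arXiv:1006.4582 — 5 statements merged into one kernel-verified Lean document; each statement's English description precedes it below -/
import Mathlib

section
/- Let G be a probability measure on [0,∞), let Λ ~ G, and conditionally on Λ = λ let Y be Poisson(λ). If the marginal probability P_G(y) = ∫ e^{-λ} λ^y / y! dG(λ) is strictly positive at y ∈ ℕ, then the posterior mean satisfies E(Λ | Y = y) = (y+1) P_G(y+1) / P_G(y) (Robbins' formula). -/
open MeasureTheory

/-- The Poisson probability mass function `e^{-λ} λ^y / y!`. -/
noncomputable def poissonPMF (l : ℝ) (y : ℕ) : ℝ :=
  Real.exp (-l) * l ^ y / (Nat.factorial y)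

/-- The Poisson mixture marginal `P_G(y) = ∫ e^{-λ} λ^y / y! dG(λ)`. -/
noncomputable def mixturePMF (G : Measure ℝ) (y : ℕ) : ℝ :=
  ∫ l, poissonPMF l y ∂G

/-- The recursion `λ p(y) = (y + 1) p(y + 1)` for the Poisson probability mass function. -/
lemma mul_poissonPMF (l : ℝ) (y : ℕ) :
    l * poissonPMF l y = ((y : ℝ) + 1) * poissonPMF l (y + 1) := by
  simp only [poissonPMF, Nat.factorial_succ, Nat.cast_mul, Nat.cast_succ]
  field_simp
  ring

/-- Robbins' formula: if the Poisson mixture marginal `P_G(y)` is strictly positive,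
then the posterior mean `E(Λ | Y = y)` equals `(y+1) P_G(y+1) / P_G(y)`. -/
theorem robbins_formula (G : Measure ℝ) [IsProbabilityMeasure G]
    (hG : ∀ᵐ l ∂G, 0 ≤ l) (y : ℕ) (hpos : 0 < mixturePMF G y) :
    (∫ l, l * poissonPMF l y ∂G) / mixturePMF G y
      = ((y : ℝ) + 1) * mixturePMF G (y + 1) / mixturePMF G y := by
  simp only [mul_poissonPMF, integral_const_mul, mixturePMF]
end

section
/- Let G be a probability measure on [0,∞) with G((0,∞)) > 0, so that the Poisson mixture marginal P_G(y) = ∫ e^{-λ} λ^y / y! dG(λ) is strictly positive for every y ∈ ℕ. Then the Bayes rule δ^G(y) = (y+1) P_G(y+1)/P_G(y) is nondecreasing in y ∈ ℕ. -/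
open MeasureTheory

/-- The Poisson moment `∫ e^{-λ} λ^y dG(λ)` is finite for every `G` carried by `[0, ∞)`. -/
lemma integrable_exp_neg_mul_pow (G : Measure ℝ) [IsFiniteMeasure G]
    (hG : ∀ᵐ l ∂G, 0 ≤ l) (y : ℕ) :
    Integrable (fun l : ℝ => Real.exp (-l) * l ^ y) G := by
  refine Integrable.of_bound (by fun_prop) (Nat.factorial y : ℝ) ?_
  filter_upwards [hG] with l hl
  have h : l ^ y ≤ Real.exp l * Nat.factorial y :=
    (div_le_iff₀ (by positivity)).1 (Real.pow_div_factorial_le_exp l hl y)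
  rw [Real.norm_of_nonneg (by positivity)]
  calc Real.exp (-l) * l ^ y ≤ Real.exp (-l) * (Real.exp l * Nat.factorial y) := by gcongr
    _ = Nat.factorial y := by rw [← mul_assoc, ← Real.exp_add]; simp

lemma integral_exp_neg_mul_pow_pos (G : Measure ℝ) [IsFiniteMeasure G]
    (hG : ∀ᵐ l ∂G, 0 ≤ l) (hpos : 0 < G (Set.Ioi 0)) (y : ℕ) :
    0 < ∫ l, Real.exp (-l) * l ^ y ∂G := by
  rw [integral_pos_iff_support_of_nonneg_ae _ (integrable_exp_neg_mul_pow G hG y)]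
  · refine hpos.trans_le (measure_mono fun l (hl : 0 < l) => ?_)
    rw [Function.mem_support]
    positivity
  · filter_upwards [hG] with l hl
    simp only [Pi.zero_apply]
    positivity

/-- Log-convexity of the moments `∫ e^{-λ} λ^y dG(λ)`. -/
lemma integral_exp_neg_mul_pow_sq_le (G : Measure ℝ) [IsFiniteMeasure G]
    (hG : ∀ᵐ l ∂G, 0 ≤ l) (hpos : 0 < G (Set.Ioi 0)) (y : ℕ) :
    (∫ l, Real.exp (-l) * l ^ (y + 1) ∂G) ^ 2 ≤
      (∫ l, Real.exp (-l) * l ^ y ∂G) * ∫ l, Real.exp (-l) * l ^ (y + 2) ∂G := by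
  set a := ∫ l, Real.exp (-l) * l ^ y ∂G
  set b := ∫ l, Real.exp (-l) * l ^ (y + 1) ∂G
  set c := ∫ l, Real.exp (-l) * l ^ (y + 2) ∂G
  have ha_pos : 0 < a := integral_exp_neg_mul_pow_pos G hG hpos y
  have hi := integrable_exp_neg_mul_pow G hG
  have hnn : 0 ≤ ∫ l, Real.exp (-l) * l ^ y * (a * l - b) ^ 2 ∂G := by
    apply integral_nonneg_of_ae
    filter_upwards [hG] with l hl
    simp only [Pi.zero_apply]
    positivity
  have heq : ∫ l, Real.exp (-l) * l ^ y * (a * l - b) ^ 2 ∂G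
      = a ^ 2 * c - 2 * a * b * b + b ^ 2 * a := by
    calc ∫ l, Real.exp (-l) * l ^ y * (a * l - b) ^ 2 ∂G
        = ∫ l, (a ^ 2 * (Real.exp (-l) * l ^ (y + 2)) -
            2 * a * b * (Real.exp (-l) * l ^ (y + 1))) +
            b ^ 2 * (Real.exp (-l) * l ^ y) ∂G := by
          congr 1
          ext l
          ring
      _ = a ^ 2 * c - 2 * a * b * b + b ^ 2 * a := by
          rw [integral_add (by fun_prop) (by fun_prop),
            integral_sub (by fun_prop) (by fun_prop),
            integral_const_mul, integral_const_mul, integral_const_mul]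
  rw [heq] at hnn
  have h : 0 ≤ a * (a * c - b ^ 2) := by linarith
  linarith [nonneg_of_mul_nonneg_right h ha_pos]

lemma mixturePMF_eq_div_factorial (G : Measure ℝ) (y : ℕ) :
    mixturePMF G y = (∫ l, Real.exp (-l) * l ^ y ∂G) / Nat.factorial y :=
  integral_div _ _

lemma succ_mul_mixturePMF_div (G : Measure ℝ) (y : ℕ) :
    ((y : ℝ) + 1) * mixturePMF G (y + 1) / mixturePMF G y =
      (∫ l, Real.exp (-l) * l ^ (y + 1) ∂G) / ∫ l, Real.exp (-l) * l ^ y ∂G := by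
  rw [mixturePMF_eq_div_factorial, mixturePMF_eq_div_factorial, Nat.factorial_succ]
  push_cast
  have h1 : (y : ℝ) + 1 ≠ 0 := by positivity
  have h2 : (Nat.factorial y : ℝ) ≠ 0 := by positivity
  field_simp

/-- If `G((0,∞)) > 0` then the Poisson mixture marginal `P_G(y)` is strictly positive for
every `y`, and the Bayes rule `δ^G(y) = (y+1) P_G(y+1)/P_G(y)` is nondecreasing in `y`. -/
theorem bayes_rule_monotone (G : Measure ℝ) [IsProbabilityMeasure G]
    (hG : ∀ᵐ l ∂G, 0 ≤ l) (hpos : 0 < G (Set.Ioi 0)) :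
    (∀ y : ℕ, 0 < mixturePMF G y) ∧
    Monotone (fun y : ℕ => ((y : ℝ) + 1) * mixturePMF G (y + 1) / mixturePMF G y) := by
  have hm := integral_exp_neg_mul_pow_pos G hG hpos
  refine ⟨fun y => ?_, monotone_nat_of_le_succ fun y => ?_⟩
  · rw [mixturePMF_eq_div_factorial]
    exact div_pos (hm y) (by positivity)
  · rw [succ_mul_mixturePMF_div, succ_mul_mixturePMF_div, div_le_div_iff₀ (hm _) (hm _)]
    linarith [integral_exp_neg_mul_pow_sq_le G hG hpos y]
end

section
/- (Tweedie's formula.) Let G be a probability measure on ℝ with ∫ |μ| dG(μ) < ∞, let M ~ G, and let Z = M + σ ε where ε ~ N(0,1) is independent of M and σ > 0. Define the marginal density g(z) = ∫ (1/σ) φ((z−μ)/σ) dG(μ), where φ is the standard normal density. Then g is differentiable, g(z) > 0 for all z, and E(M | Z = z) = z + σ² g'(z)/g(z) for every z ∈ ℝ. -/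
open MeasureTheory

/-- The standard normal density `φ(x) = (2π)^{-1/2} e^{-x²/2}`. -/
noncomputable def stdNormalPDF (x : ℝ) : ℝ :=
  Real.exp (-(x ^ 2) / 2) / Real.sqrt (2 * Real.pi)

/-- The marginal density `g(z) = ∫ (1/σ) φ((z−μ)/σ) dG(μ)` of `Z = M + σ ε`. -/
noncomputable def gMarginal (G : Measure ℝ) (σ : ℝ) (z : ℝ) : ℝ :=
  ∫ μ, (1 / σ) * stdNormalPDF ((z - μ) / σ) ∂G

lemma stdNormalPDF_pos (x : ℝ) : 0 < stdNormalPDF x := by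
  unfold stdNormalPDF
  positivity

lemma one_le_sqrt_two_mul_pi : 1 ≤ Real.sqrt (2 * Real.pi) := by
  rw [Real.one_le_sqrt]
  linarith [Real.pi_gt_three]

lemma stdNormalPDF_le_one (x : ℝ) : stdNormalPDF x ≤ 1 := by
  unfold stdNormalPDF
  refine div_le_one_of_le₀ (le_trans ?_ one_le_sqrt_two_mul_pi) (Real.sqrt_nonneg _)
  rw [Real.exp_le_one_iff]
  nlinarith [sq_nonneg x]

lemma abs_mul_stdNormalPDF_le_one (x : ℝ) : |x| * stdNormalPDF x ≤ 1 := by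
  unfold stdNormalPDF
  rw [← mul_div_assoc]
  refine div_le_one_of_le₀ (le_trans ?_ one_le_sqrt_two_mul_pi) (Real.sqrt_nonneg _)
  rw [neg_div, Real.exp_neg, ← div_eq_mul_inv, div_le_one (Real.exp_pos _)]
  nlinarith [Real.add_one_le_exp (x ^ 2 / 2), sq_nonneg (|x| - 1), sq_abs x]

lemma hasDerivAt_stdNormalPDF (x : ℝ) :
    HasDerivAt stdNormalPDF (-x * stdNormalPDF x) x := by
  have h : HasDerivAt (fun y : ℝ => -(y ^ 2) / 2) (-x) x :=
    ((hasDerivAt_pow 2 x).fun_neg.div_const 2).congr_deriv (by push_cast; ring)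
  refine (h.exp.div_const (Real.sqrt (2 * Real.pi))).congr_deriv ?_
  unfold stdNormalPDF
  ring

lemma continuous_stdNormalPDF : Continuous stdNormalPDF := by
  unfold stdNormalPDF
  fun_prop

lemma integrable_scaled_stdNormalPDF (G : Measure ℝ) [IsFiniteMeasure G] (σ z : ℝ) :
    Integrable (fun μ => (1 / σ) * stdNormalPDF ((z - μ) / σ)) G := by
  refine Integrable.const_mul (Integrable.of_bound (C := 1) ?_ (.of_forall fun μ => ?_)) _
  · exact (continuous_stdNormalPDF.comp (by fun_prop)).aestronglyMeasurable
  · rw [Real.norm_of_nonneg (stdNormalPDF_pos _).le]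
    exact stdNormalPDF_le_one _

lemma gMarginal_pos (G : Measure ℝ) [IsProbabilityMeasure G] {σ : ℝ} (hσ : 0 < σ) (z : ℝ) :
    0 < gMarginal G σ z := by
  have hpos (μ : ℝ) : 0 < (1 / σ) * stdNormalPDF ((z - μ) / σ) :=
    mul_pos (by positivity) (stdNormalPDF_pos _)
  rw [gMarginal, integral_pos_iff_support_of_nonneg (fun μ => (hpos μ).le)
    (integrable_scaled_stdNormalPDF G σ z),
    Set.eq_univ_of_forall fun μ => Function.mem_support.mpr (hpos μ).ne']
  simp

lemma hasDerivAt_gMarginal (G : Measure ℝ) [IsFiniteMeasure G] {σ : ℝ} (hσ : 0 < σ) (z : ℝ) :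
    Integrable (fun μ => (μ - z) / σ ^ 2 * ((1 / σ) * stdNormalPDF ((z - μ) / σ))) G ∧
      HasDerivAt (gMarginal G σ)
        (∫ μ, (μ - z) / σ ^ 2 * ((1 / σ) * stdNormalPDF ((z - μ) / σ)) ∂G) z := by
  refine hasDerivAt_integral_of_dominated_loc_of_deriv_le
    (F := fun z μ => (1 / σ) * stdNormalPDF ((z - μ) / σ))
    (F' := fun z μ => (μ - z) / σ ^ 2 * ((1 / σ) * stdNormalPDF ((z - μ) / σ)))
    (bound := fun _ => 1 / σ ^ 2) Filter.univ_mem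
    (.of_forall fun y => (integrable_scaled_stdNormalPDF G σ y).aestronglyMeasurable)
    (integrable_scaled_stdNormalPDF G σ z) ?_ (.of_forall fun μ y _ => ?_)
    (integrable_const _) (.of_forall fun μ y _ => ?_)
  · have := continuous_stdNormalPDF
    exact Continuous.aestronglyMeasurable (by fun_prop)
  · have h : (μ - y) / σ ^ 2 * ((1 / σ) * stdNormalPDF ((y - μ) / σ)) =
        1 / σ ^ 2 * (-((y - μ) / σ) * stdNormalPDF ((y - μ) / σ)) := by ring
    rw [h, norm_mul, norm_mul, norm_neg, Real.norm_of_nonneg (by positivity : 0 ≤ 1 / σ ^ 2),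
      Real.norm_of_nonneg (stdNormalPDF_pos _).le]
    exact mul_le_of_le_one_right (by positivity) (abs_mul_stdNormalPDF_le_one _)
  · have h : HasDerivAt (fun y : ℝ => (y - μ) / σ) (1 / σ) y :=
      ((hasDerivAt_id y).sub_const μ).div_const σ
    refine (((hasDerivAt_stdNormalPDF _).comp y h).const_mul (1 / σ)).congr_deriv ?_
    ring

/-- Tweedie's formula: if `∫ |μ| dG(μ) < ∞` then the marginal density `g` is differentiable
and everywhere positive, and the posterior mean satisfies
`E(M | Z = z) = z + σ² g'(z)/g(z)` for every `z`. -/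
theorem tweedie_formula (G : Measure ℝ) [IsProbabilityMeasure G] (σ : ℝ) (hσ : 0 < σ)
    (hint : Integrable (fun μ : ℝ => |μ|) G) :
    Differentiable ℝ (gMarginal G σ) ∧ (∀ z : ℝ, 0 < gMarginal G σ z) ∧
    ∀ z : ℝ, (∫ μ, μ * ((1 / σ) * stdNormalPDF ((z - μ) / σ)) ∂G) / gMarginal G σ z
        = z + σ ^ 2 * deriv (gMarginal G σ) z / gMarginal G σ z := by
  refine ⟨fun z => (hasDerivAt_gMarginal G hσ z).2.differentiableAt,
    gMarginal_pos G hσ, fun z => ?_⟩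
  obtain ⟨hderiv_int, hderiv⟩ := hasDerivAt_gMarginal G hσ z
  have hnum : ∫ μ, μ * ((1 / σ) * stdNormalPDF ((z - μ) / σ)) ∂G =
      z * gMarginal G σ z + σ ^ 2 * deriv (gMarginal G σ) z := by
    rw [hderiv.deriv, gMarginal, ← integral_const_mul, ← integral_const_mul,
      ← integral_add ((integrable_scaled_stdNormalPDF G σ z).const_mul z)
        (hderiv_int.const_mul (σ ^ 2))]
    refine integral_congr_ae (.of_forall fun μ => ?_)
    field_simp
    ring
  rw [hnum, add_div, mul_div_cancel_right₀ _ (gMarginal_pos G hσ z).ne']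
end

section
/- Let 0 < a ≤ b and let G be a probability measure supported on [a, b]. Extend the Bayes rule to real arguments by δ^G(y) = m_{y+1}/m_y for y ∈ [0,∞), where m_y = ∫ λ^y e^{-λ} dG(λ). Then y ↦ δ^G(y) is differentiable on [0,∞) with derivative (δ^G)'(y) = Cov_{ν_y}(λ, log λ) ≥ 0, where ν_y is the probability measure with dν_y(λ) = λ^y e^{-λ} dG(λ)/m_y. In particular δ^G is monotone nondecreasing on [0,∞). -/
open MeasureTheory

/-- The moments `m_y = ∫ λ^y e^{-λ} dG(λ)` for real exponent `y`. -/
noncomputable def momG (G : Measure ℝ) (y : ℝ) : ℝ :=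
  ∫ l, l ^ y * Real.exp (-l) ∂G

/-- The extended Bayes rule `δ^G(y) = m_{y+1}/m_y` for real `y`. -/
noncomputable def bayesRuleExt (G : Measure ℝ) (y : ℝ) : ℝ :=
  momG G (y + 1) / momG G y

/-- The covariance `Cov_{ν_y}(λ, log λ)` under the tilted probability measure
`dν_y(λ) = λ^y e^{-λ} dG(λ)/m_y`. -/
noncomputable def covTilted (G : Measure ℝ) (y : ℝ) : ℝ :=
  (∫ l, (l * Real.log l) * (l ^ y * Real.exp (-l)) ∂G) / momG G y
    - ((∫ l, l * (l ^ y * Real.exp (-l)) ∂G) / momG G y)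
      * ((∫ l, Real.log l * (l ^ y * Real.exp (-l)) ∂G) / momG G y)

/-- A function continuous on `[a, b]` is integrable against a finite measure carried by `[a, b]`. -/
theorem integrable_of_continuousOn_Icc {a b : ℝ} {G : Measure ℝ} [IsFiniteMeasure G]
    (hsupp : ∀ᵐ l ∂G, l ∈ Set.Icc a b) {g : ℝ → ℝ} (hg : ContinuousOn g (Set.Icc a b)) :
    Integrable g G := by
  have h := hg.integrableOn_compact (μ := G) isCompact_Icc
  rwa [IntegrableOn, Measure.restrict_eq_self_of_ae_mem hsupp] at h

theorem continuousOn_rpow_mul_exp_neg {a : ℝ} (ha : 0 < a) (b y : ℝ) :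
    ContinuousOn (fun l : ℝ => l ^ y * Real.exp (-l)) (Set.Icc a b) :=
  (continuousOn_id.rpow_const fun _ hl => Or.inl (ha.trans_le hl.1).ne').mul
    (by fun_prop)

theorem continuousOn_log_Icc {a : ℝ} (ha : 0 < a) (b : ℝ) :
    ContinuousOn Real.log (Set.Icc a b) :=
  Real.continuousOn_log.mono fun _ hl => (ha.trans_le hl.1).ne'

theorem rpow_le_rpow_add_one_add_rpow_sub_one {l x y : ℝ} (hl : 0 < l)
    (hx : x ∈ Set.Ioo (y - 1) (y + 1)) : l ^ x ≤ l ^ (y + 1) + l ^ (y - 1) := by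
  have h₁ := Real.rpow_nonneg hl.le (y + 1)
  have h₂ := Real.rpow_nonneg hl.le (y - 1)
  rcases le_total 1 l with h | h
  · have := Real.rpow_le_rpow_of_exponent_le h hx.2.le
    linarith
  · have := Real.rpow_le_rpow_of_exponent_ge hl h hx.1.le
    linarith

theorem hasDerivAt_momG {a b : ℝ} (ha : 0 < a) {G : Measure ℝ} [IsFiniteMeasure G]
    (hsupp : ∀ᵐ l ∂G, l ∈ Set.Icc a b) (y : ℝ) :
    HasDerivAt (momG G) (∫ l, Real.log l * (l ^ y * Real.exp (-l)) ∂G) y := by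
  have hw := continuousOn_rpow_mul_exp_neg ha b
  have hlog := continuousOn_log_Icc ha b
  refine (hasDerivAt_integral_of_dominated_loc_of_deriv_le (μ := G)
    (F := fun y l => l ^ y * Real.exp (-l))
    (F' := fun y l => Real.log l * (l ^ y * Real.exp (-l)))
    (bound := fun l => |Real.log l| *
      (l ^ (y + 1) * Real.exp (-l) + l ^ (y - 1) * Real.exp (-l)))
    (Ioo_mem_nhds (sub_one_lt y) (lt_add_one y))
    (Filter.Eventually.of_forall fun x =>
      (integrable_of_continuousOn_Icc hsupp (hw x)).aestronglyMeasurable)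
    (integrable_of_continuousOn_Icc hsupp (hw y))
    (integrable_of_continuousOn_Icc hsupp (hlog.mul (hw y))).aestronglyMeasurable
    ?_ (integrable_of_continuousOn_Icc hsupp (hlog.abs.mul ((hw _).add (hw _)))) ?_).2
  · filter_upwards [hsupp] with l hl x hx
    have hl₀ : 0 < l := ha.trans_le hl.1
    rw [Real.norm_eq_abs, abs_mul, abs_of_nonneg (a := l ^ x * Real.exp (-l)) (by positivity),
      ← add_mul]
    gcongr
    exact rpow_le_rpow_add_one_add_rpow_sub_one hl₀ hx
  · filter_upwards [hsupp] with l hl x _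
    have hl₀ : 0 < l := ha.trans_le hl.1
    refine ((Real.hasStrictDerivAt_const_rpow hl₀ x).hasDerivAt.mul_const
      (Real.exp (-l))).congr_deriv ?_
    ring

theorem momG_pos {a b : ℝ} (ha : 0 < a) {G : Measure ℝ} [IsProbabilityMeasure G]
    (hsupp : ∀ᵐ l ∂G, l ∈ Set.Icc a b) (y : ℝ) : 0 < momG G y := by
  have hpos : ∀ᵐ l ∂G, 0 < l ^ y * Real.exp (-l) := by
    filter_upwards [hsupp] with l hl
    have hl₀ : 0 < l := ha.trans_le hl.1
    positivity
  have hnonneg : 0 ≤ᵐ[G] fun l => l ^ y * Real.exp (-l) := hpos.mono fun _ h => h.le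
  have hint := integrable_of_continuousOn_Icc hsupp (continuousOn_rpow_mul_exp_neg ha b y)
  refine (integral_nonneg_of_ae hnonneg).lt_of_ne' fun h => ?_
  have hzero := (integral_eq_zero_iff_of_nonneg_ae hnonneg hint).1 h
  obtain ⟨l, hl, hl'⟩ := (hpos.and hzero).exists
  exact hl.ne' hl'

theorem momG_add_one {a b : ℝ} (ha : 0 < a) {G : Measure ℝ}
    (hsupp : ∀ᵐ l ∂G, l ∈ Set.Icc a b) (y : ℝ) :
    momG G (y + 1) = ∫ l, l * (l ^ y * Real.exp (-l)) ∂G := by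
  refine integral_congr_ae ?_
  filter_upwards [hsupp] with l hl
  rw [Real.rpow_add_one (ha.trans_le hl.1).ne']
  ring

theorem hasDerivAt_bayesRuleExt {a b : ℝ} (ha : 0 < a) {G : Measure ℝ} [IsProbabilityMeasure G]
    (hsupp : ∀ᵐ l ∂G, l ∈ Set.Icc a b) (y : ℝ) :
    HasDerivAt (bayesRuleExt G) (covTilted G y) y := by
  have hm := (momG_pos ha hsupp y).ne'
  have hnum := (hasDerivAt_momG ha hsupp (y + 1)).comp_add_const y 1
  have hlog : ∫ l, Real.log l * (l ^ (y + 1) * Real.exp (-l)) ∂G =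
      ∫ l, (l * Real.log l) * (l ^ y * Real.exp (-l)) ∂G := by
    refine integral_congr_ae ?_
    filter_upwards [hsupp] with l hl
    rw [Real.rpow_add_one (ha.trans_le hl.1).ne']
    ring
  rw [hlog] at hnum
  refine (hnum.fun_div (hasDerivAt_momG ha hsupp y) hm).congr_deriv ?_
  rw [covTilted, momG_add_one ha hsupp]
  field_simp

/-- Positive association of `λ` and `log λ` under the tilted measure: integrate
`(λ - c) (log λ - log c) ≥ 0`, where `c` is the tilted mean of `λ`. -/
theorem covTilted_nonneg {a b : ℝ} (ha : 0 < a) {G : Measure ℝ} [IsProbabilityMeasure G]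
    (hsupp : ∀ᵐ l ∂G, l ∈ Set.Icc a b) (y : ℝ) : 0 ≤ covTilted G y := by
  have hm := momG_pos ha hsupp y
  have hw := continuousOn_rpow_mul_exp_neg ha b y
  have hlog := continuousOn_log_Icc ha b
  have hi₀ : Integrable (fun l => l ^ y * Real.exp (-l)) G :=
    integrable_of_continuousOn_Icc hsupp hw
  have hi₁ : Integrable (fun l => l * (l ^ y * Real.exp (-l))) G :=
    integrable_of_continuousOn_Icc hsupp (continuousOn_id.mul hw)
  have hi₂ : Integrable (fun l => Real.log l * (l ^ y * Real.exp (-l))) G :=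
    integrable_of_continuousOn_Icc hsupp (hlog.mul hw)
  have hi₃ : Integrable (fun l => (l * Real.log l) * (l ^ y * Real.exp (-l))) G :=
    integrable_of_continuousOn_Icc hsupp ((continuousOn_id.mul hlog).mul hw)
  have hc : 0 < bayesRuleExt G y := div_pos (momG_pos ha hsupp (y + 1)) hm
  have hcm : bayesRuleExt G y * momG G y = ∫ l, l * (l ^ y * Real.exp (-l)) ∂G := by
    rw [bayesRuleExt, div_mul_cancel₀ _ hm.ne', momG_add_one ha hsupp]
  generalize bayesRuleExt G y = c at hc hcm
  have hnonneg : 0 ≤ ∫ l, ((l * Real.log l) * (l ^ y * Real.exp (-l))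
      - c * (Real.log l * (l ^ y * Real.exp (-l))))
      - (Real.log c * (l * (l ^ y * Real.exp (-l)))
        - Real.log c * c * (l ^ y * Real.exp (-l))) ∂G := by
    refine integral_nonneg_of_ae ?_
    filter_upwards [hsupp] with l hl
    have hl₀ : 0 < l := ha.trans_le hl.1
    have hprod : 0 ≤ (l - c) * (Real.log l - Real.log c) := by
      rcases le_total l c with h | h
      · exact mul_nonneg_of_nonpos_of_nonpos (sub_nonpos.2 h)
          (sub_nonpos.2 (Real.log_le_log hl₀ h))
      · exact mul_nonneg (sub_nonneg.2 h) (sub_nonneg.2 (Real.log_le_log hc h))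
    have hweight : 0 ≤ l ^ y * Real.exp (-l) := by positivity
    have := mul_nonneg hprod hweight
    simp only [Pi.zero_apply]
    linarith
  have hl : Integrable (fun l => (l * Real.log l) * (l ^ y * Real.exp (-l))
      - c * (Real.log l * (l ^ y * Real.exp (-l)))) G := hi₃.sub (hi₂.const_mul c)
  have hr : Integrable (fun l => Real.log c * (l * (l ^ y * Real.exp (-l)))
      - Real.log c * c * (l ^ y * Real.exp (-l))) G := (hi₁.const_mul _).sub (hi₀.const_mul _)
  rw [integral_sub hl hr,
    integral_sub hi₃ (hi₂.const_mul c),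
    integral_sub (hi₁.const_mul _) (hi₀.const_mul _), integral_const_mul, integral_const_mul,
    integral_const_mul, ← hcm] at hnonneg
  change 0 ≤ _ - _ - (_ - _ * momG G y) at hnonneg
  rw [covTilted, ← hcm, mul_div_cancel_right₀ _ hm.ne', mul_div_assoc', ← sub_div]
  refine div_nonneg ?_ hm.le
  linarith

/-- If `G` is supported on `[a, b]` with `0 < a ≤ b`, the extended Bayes rule
`y ↦ δ^G(y) = m_{y+1}/m_y` is differentiable on `[0,∞)` with derivative
`Cov_{ν_y}(λ, log λ) ≥ 0`; in particular it is monotone nondecreasing on `[0,∞)`. -/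
theorem bayes_rule_ext_monotone (a b : ℝ) (ha : 0 < a) (hab : a ≤ b)
    (G : Measure ℝ) [IsProbabilityMeasure G]
    (hsupp : ∀ᵐ l ∂G, l ∈ Set.Icc a b) :
    (∀ y : ℝ, 0 ≤ y →
        HasDerivAt (bayesRuleExt G) (covTilted G y) y ∧ 0 ≤ covTilted G y) ∧
    MonotoneOn (bayesRuleExt G) (Set.Ici 0) := by
  have hderiv := hasDerivAt_bayesRuleExt ha hsupp
  have hcov := covTilted_nonneg ha hsupp
  exact ⟨fun y _ => ⟨hderiv y, hcov y⟩, (monotone_of_hasDerivAt_nonneg hderiv hcov).monotoneOn _⟩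
end

section
/- Let P be a real polynomial of degree q ≥ 0. Then the set { x ∈ ℝ : P(x) = e^x } has at most q + 1 elements. Consequently, for data y₁,…,y_n ∈ ℕ and any pmf values p(y_i) > 0, the set of λ ≥ 0 satisfying the NPMLE stationarity equation Σ_{i=1}^n λ^{y_i}/(y_i! p(y_i)) = n e^{λ} is finite, of cardinality at most max_i y_i + 1; hence the support of the nonparametric maximum likelihood estimate of the mixing distribution is finite with at most max_i y_i + 1 atoms. -/
/-- A quantitative form of **Rolle's theorem**: a differentiable function has at most one more zero
than its derivative. -/
theorem encard_zeros_le_encard_zeros_deriv_add_one {f f' : ℝ → ℝ}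
    (hf : ∀ x, HasDerivAt f (f' x) x) :
    {x | f x = 0}.encard ≤ {x | f' x = 0}.encard + 1 := by
  rcases Set.finite_or_infinite {x | f' x = 0} with hfin | hinf
  · have card_le (s : Finset ℝ) (hs : (s : Set ℝ) ⊆ {x | f x = 0}) :
        s.card ≤ hfin.toFinset.card + 1 := by
      refine Finset.card_le_of_interleaved fun x hx y hy hxy _ ↦ ?_
      obtain ⟨z, hz, hz'⟩ := exists_hasDerivAt_eq_zero hxy
        (fun w _ ↦ (hf w).continuousAt.continuousWithinAt)
        ((hs hx).trans (hs hy).symm) (fun w _ ↦ hf w)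
      exact ⟨z, by simpa using hz', hz⟩
    by_contra! hlt
    rw [hfin.encard_eq_coe_toFinset_card] at hlt
    obtain ⟨t, ht, htcard⟩ := Set.exists_subset_encard_eq (Order.add_one_le_of_lt hlt)
    have htfin : t.Finite := Set.finite_of_encard_eq_coe (k := hfin.toFinset.card + 1 + 1) (by
      rw [htcard]; push_cast; rfl)
    have h := card_le htfin.toFinset (by simpa using ht)
    rw [htfin.encard_eq_coe_toFinset_card] at htcard
    have : htfin.toFinset.card = hfin.toFinset.card + 1 + 1 := by exact_mod_cast htcard
    omega
  · simp [hinf.encard_eq]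

theorem Polynomial.encard_eval_eq_exp_le {k : ℕ} {P : Polynomial ℝ} (hP : P.natDegree ≤ k) :
    {x : ℝ | P.eval x = Real.exp x}.encard ≤ (k + 1 : ℕ) := by
  induction k generalizing P with
  | zero =>
    rw [Polynomial.eq_C_of_natDegree_le_zero hP]
    simp only [Polynomial.eval_C, zero_add, Nat.cast_one, Set.encard_le_one_iff]
    exact fun a b ha hb ↦ Real.exp_injective (ha.symm.trans hb)
  | succ k ih =>
    have hderiv := ih (P := P.derivative) (by have := P.natDegree_derivative_le; omega)
    have hrolle := encard_zeros_le_encard_zeros_deriv_add_one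
      fun x ↦ (P.hasDerivAt x).sub (Real.hasDerivAt_exp x)
    simp only [Pi.sub_apply, sub_eq_zero] at hrolle
    push_cast at hderiv ⊢
    exact hrolle.trans (by gcongr)

/-- A real polynomial of degree `q` can equal `e^x` at most `q + 1` times.  Consequently, for
data `y₁,…,y_n ∈ ℕ` and pmf values `p(yᵢ) > 0`, the set of `λ ≥ 0` solving the NPMLE
stationarity equation `∑ᵢ λ^{yᵢ}/(yᵢ! p(yᵢ)) = n e^λ` is finite with at most
`maxᵢ yᵢ + 1` elements (hence the NPMLE mixing distribution has at most that many atoms). -/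
theorem npmle_support_finite (P : Polynomial ℝ) (n : ℕ) (hn : 0 < n) (y : Fin n → ℕ)
    (p : ℕ → ℝ) (hp : ∀ i, 0 < p (y i)) :
    ({x : ℝ | P.eval x = Real.exp x}.Finite ∧
      {x : ℝ | P.eval x = Real.exp x}.ncard ≤ P.natDegree + 1) ∧
    ({l : ℝ | 0 ≤ l ∧
        (∑ i, l ^ (y i) / ((Nat.factorial (y i) : ℝ) * p (y i))) = n * Real.exp l}.Finite ∧
      {l : ℝ | 0 ≤ l ∧
        (∑ i, l ^ (y i) / ((Nat.factorial (y i) : ℝ) * p (y i))) = n * Real.exp l}.ncard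
        ≤ Finset.univ.sup y + 1) := by
  refine ⟨Set.encard_le_coe_iff_finite_ncard_le.1 (Polynomial.encard_eval_eq_exp_le le_rfl),
    Set.encard_le_coe_iff_finite_ncard_le.1 ?_⟩
  have hn' : (n : ℝ) ≠ 0 := by positivity
  let Q : Polynomial ℝ := Polynomial.C (n : ℝ)⁻¹ *
    ∑ i, Polynomial.C ((Nat.factorial (y i) : ℝ) * p (y i))⁻¹ * Polynomial.X ^ y i
  have hQ : Q.natDegree ≤ Finset.univ.sup y :=
    (Polynomial.natDegree_C_mul_le _ _).trans <|
      Polynomial.natDegree_sum_le_of_forall_le _ _ fun i hi ↦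
        (Polynomial.natDegree_C_mul_X_pow_le _ _).trans (Finset.le_sup hi)
  refine (Set.encard_le_encard ?_).trans (Polynomial.encard_eval_eq_exp_le hQ)
  rintro l ⟨-, hl⟩
  have heval : Q.eval l =
      (n : ℝ)⁻¹ * ∑ i, l ^ (y i) / ((Nat.factorial (y i) : ℝ) * p (y i)) := by
    simp only [Q, Polynomial.eval_mul, Polynomial.eval_C, Polynomial.eval_finsetSum,
      Polynomial.eval_pow, Polynomial.eval_X, div_eq_inv_mul]
  rw [Set.mem_ofPred_eq, heval, hl, inv_mul_cancel_left₀ hn']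
end
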